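/- arXiv:1612.08865 — 7 statements merged into one kernel-verified Lean document; each statement's English description precedes it below -/
import Mathlib

section
/- For every real p > 1, the number τ_p satisfies 0 ≤ τ_p ≤ 0.36. -/
/-- The defining equation of `τ_p` has no solution at `0.36`: there the left side is smaller. -/
lemma two_mul_rpow_lt_one_add_rpow {p : ℝ} (hp : 1 < p) :
    2 * (0.64 : ℝ) ^ p < 1 + (0.36 : ℝ) ^ p := by
  have split : ∀ x : ℝ, 0 < x → x ^ p = x * x ^ (p - 1) := fun x hx => by
    rw [Real.rpow_sub_one hx.ne', mul_div_cancel₀ _ hx.ne']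
  rw [split 0.64 (by norm_num), split 0.36 (by norm_num)]
  have cube_le : ((0.64 : ℝ) ^ (p - 1)) ^ 3 ≤ (0.36 : ℝ) ^ (p - 1) := by
    rw [Real.rpow_pow_comm (by norm_num)]
    exact Real.rpow_le_rpow (by norm_num) (by norm_num) (by linarith)
  have y_nonneg : 0 ≤ (0.64 : ℝ) ^ (p - 1) := by positivity
  have y_le_one : (0.64 : ℝ) ^ (p - 1) ≤ 1 :=
    Real.rpow_le_one (by norm_num) (by norm_num) (by linarith)
  generalize (0.64 : ℝ) ^ (p - 1) = y at *
  -- `y ^ 3 ≥ 3 * y - 2` for `y ≥ 0`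
  nlinarith [mul_nonneg (sq_nonneg (y - 1)) (by linarith : 0 ≤ y + 2)]

/-- For every real `p > 1`, the number `τ_p` (the unique real with
`0 ≤ τ_p < 1` and `2 (1 - τ_p)^p = 1 + τ_p^p`) satisfies `0 ≤ τ_p ≤ 0.36`. -/
theorem stmt_1 (p : ℝ) (hp : 1 < p) (τp : ℝ)
    (hτp : 0 ≤ τp ∧ τp < 1 ∧ 2 * (1 - τp) ^ p = 1 + τp ^ p) :
    0 ≤ τp ∧ τp ≤ 0.36 := by
  obtain ⟨h0, h1, h⟩ := hτp
  refine ⟨h0, ?_⟩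
  by_contra! hlt
  have hleft : (1 - τp) ^ p ≤ (0.64 : ℝ) ^ p :=
    Real.rpow_le_rpow (by linarith) (by norm_num at hlt ⊢; linarith) (by linarith)
  have hright : (0.36 : ℝ) ^ p ≤ τp ^ p :=
    Real.rpow_le_rpow (by norm_num) hlt.le (by linarith)
  linarith [two_mul_rpow_lt_one_add_rpow hp]
end

section
/- For every real p > 1 and every real σ with 1 ≤ σ ≤ σ_p, there exists a unique real number τ with 0 ≤ τ ≤ τ_p such that A^p + B^p = 1, where A = (1 + τ^p)^{-1/p} - (1 + σ^p)^{-1/p} and B = σ(1 + σ^p)^{-1/p} + τ(1 + τ^p)^{-1/p}. -/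
/-- `σ_p = (2^p - 1)^{1/p}`. -/
noncomputable def sigmaP (p : ℝ) : ℝ := (2 ^ p - 1) ^ (1 / p)

/-- `A = A(p,σ,τ) = (1 + τ^p)^{-1/p} - (1 + σ^p)^{-1/p}`. -/
noncomputable def Acoef (p σ τ : ℝ) : ℝ := (1 + τ ^ p) ^ (-1 / p) - (1 + σ ^ p) ^ (-1 / p)

/-- `B = B(p,σ,τ) = σ (1 + σ^p)^{-1/p} + τ (1 + τ^p)^{-1/p}`. -/
noncomputable def Bcoef (p σ τ : ℝ) : ℝ :=
  σ * (1 + σ ^ p) ^ (-1 / p) + τ * (1 + τ ^ p) ^ (-1 / p)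

/-- For `p > 1` and `h > 0`, the increment `(z + h)^p - z^p` is strictly increasing in `z ≥ 0`. -/
theorem rpow_increment_lt {p : ℝ} (hp : 1 < p) {z w h : ℝ} (hz : 0 ≤ z) (hzw : z < w)
    (hh : 0 < h) : (z + h) ^ p - z ^ p < (w + h) ^ p - w ^ p := by
  have hd : 0 < w + h - z := by linarith
  have hwz : 0 < w - z := by linarith
  have hl : 0 < h / (w + h - z) := by positivity
  have hm : 0 < (w - z) / (w + h - z) := by positivity
  have hsum : h / (w + h - z) + (w - z) / (w + h - z) = 1 := by
    field_simp
    ring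
  have hconv := strictConvexOn_rpow hp
  have hz' : z ∈ Set.Ici (0 : ℝ) := hz
  have hw' : w + h ∈ Set.Ici (0 : ℝ) := by
    simp only [Set.mem_Ici]
    linarith
  have hne : z ≠ w + h := by linarith
  have h₁ := hconv.2 hz' hw' hne hl hm hsum
  have h₂ := hconv.2 hz' hw' hne hm hl (by linarith)
  have e₁ : h / (w + h - z) * z + (w - z) / (w + h - z) * (w + h) = w := by
    field_simp
    ring
  have e₂ : (w - z) / (w + h - z) * z + h / (w + h - z) * (w + h) = z + h := by
    field_simp
    ring
  simp only [smul_eq_mul] at h₁ h₂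
  rw [e₁] at h₁
  rw [e₂] at h₂
  have e₃ : h / (w + h - z) = 1 - (w - z) / (w + h - z) := by linarith
  rw [e₃] at h₁ h₂
  linarith

theorem one_add_rpow_pos {p s : ℝ} (hs : 0 ≤ s) : 0 < 1 + s ^ p := by
  have := Real.rpow_nonneg hs p
  linarith

/-- The point `(1, s) / (1 + s^p)^{1/p}` lies on the unit circle of the `p`-norm. -/
theorem normalized_rpow_add {p s : ℝ} (hp : 1 < p) (hs : 0 ≤ s) :
    ((1 + s ^ p) ^ (-1 / p)) ^ p + (s * (1 + s ^ p) ^ (-1 / p)) ^ p = 1 := by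
  have h := one_add_rpow_pos (p := p) hs
  have hp0 : p ≠ 0 := by linarith
  have e : ((1 + s ^ p) ^ (-1 / p)) ^ p = (1 + s ^ p)⁻¹ := by
    rw [← Real.rpow_mul h.le, div_mul_cancel₀ _ hp0, Real.rpow_neg_one]
  rw [Real.mul_rpow hs (Real.rpow_nonneg h.le _), e]
  field_simp

theorem normalized_fst_lt {p s t : ℝ} (hp : 1 < p) (hs : 0 ≤ s) (hst : s < t) :
    (1 + t ^ p) ^ (-1 / p) < (1 + s ^ p) ^ (-1 / p) := by
  have h := Real.rpow_lt_rpow hs hst (by linarith : 0 < p)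
  exact Real.rpow_lt_rpow_of_neg (one_add_rpow_pos hs) (by linarith)
    (div_neg_of_neg_of_pos (by norm_num) (by linarith))

theorem normalized_snd_lt {p s t : ℝ} (hp : 1 < p) (hs : 0 ≤ s) (hst : s < t) :
    s * (1 + s ^ p) ^ (-1 / p) < t * (1 + t ^ p) ^ (-1 / p) := by
  have ht : 0 ≤ t := hs.trans hst.le
  have hp0 : 0 < p := by linarith
  have h₁ := normalized_rpow_add hp hs
  have h₂ := normalized_rpow_add hp ht
  have h₃ := Real.rpow_lt_rpow (Real.rpow_nonneg (one_add_rpow_pos ht).le _)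
    (normalized_fst_lt hp hs hst) hp0
  refine (Real.rpow_lt_rpow_iff
    (mul_nonneg hs (Real.rpow_nonneg (one_add_rpow_pos hs).le _))
    (mul_nonneg ht (Real.rpow_nonneg (one_add_rpow_pos ht).le _)) hp0).1 ?_
  linarith

/-- The distance between the two unit vectors is strictly increasing in `τ ∈ [0, σ]`. -/
theorem distance_strictMonoOn {p σ : ℝ} (hp : 1 < p) (hσ : 0 < σ) :
    StrictMonoOn (fun τ => Acoef p σ τ ^ p + Bcoef p σ τ ^ p) (Set.Icc 0 σ) := by
  rintro s ⟨hs, hsσ⟩ t ⟨ht, htσ⟩ hst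
  have hs' := normalized_rpow_add hp hs
  have ht' := normalized_rpow_add hp ht
  have hx := normalized_fst_lt hp hs hst
  have hy := normalized_snd_lt hp hs hst
  have hA : 0 ≤ Acoef p σ t := by
    rcases htσ.eq_or_lt with h | h
    · simp [Acoef, h]
    · exact sub_nonneg.2 (normalized_fst_lt hp ht h).le
  have ha : 0 < (1 + σ ^ p) ^ (-1 / p) := Real.rpow_pos_of_pos (one_add_rpow_pos hσ.le) _
  have hys : 0 ≤ s * (1 + s ^ p) ^ (-1 / p) :=
    mul_nonneg hs (Real.rpow_nonneg (one_add_rpow_pos hs).le _)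
  have hAst : Acoef p σ t < Acoef p σ s := sub_lt_sub_right hx _
  have h₁ := rpow_increment_lt hp hA hAst ha
  have h₂ := rpow_increment_lt hp hys hy (mul_pos hσ ha)
  have e₁ : Acoef p σ t + (1 + σ ^ p) ^ (-1 / p) = (1 + t ^ p) ^ (-1 / p) := by simp [Acoef]
  have e₂ : Acoef p σ s + (1 + σ ^ p) ^ (-1 / p) = (1 + s ^ p) ^ (-1 / p) := by simp [Acoef]
  rw [e₁, e₂] at h₁
  rw [add_comm (s * _), add_comm (t * _)] at h₂
  simp only [Bcoef]
  linarith

theorem distance_continuousOn {p σ : ℝ} (hp : 1 < p) :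
    ContinuousOn (fun τ => Acoef p σ τ ^ p + Bcoef p σ τ ^ p) (Set.Ici 0) := by
  have hp0 : 0 ≤ p := by linarith
  have hN : ContinuousOn (fun s : ℝ => (1 + s ^ p) ^ (-1 / p)) (Set.Ici 0) :=
    (continuous_const.add (Real.continuous_rpow_const hp0)).continuousOn.rpow_const
      fun s hs => Or.inl (one_add_rpow_pos hs).ne'
  exact ((hN.sub continuousOn_const).rpow_const fun _ _ => Or.inr hp0).add
    ((continuousOn_const.add (continuousOn_id.mul hN)).rpow_const fun _ _ => Or.inr hp0)

theorem distance_zero_le_one {p σ : ℝ} (hp : 1 < p) (hσ : 0 ≤ σ) (hσp : σ ≤ sigmaP p) :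
    Acoef p σ 0 ^ p + Bcoef p σ 0 ^ p ≤ 1 := by
  have hp0 : 0 < p := by linarith
  have hpos := one_add_rpow_pos (p := p) hσ
  have h2 : (1 : ℝ) ≤ 2 ^ p := Real.one_le_rpow (by norm_num) hp0.le
  have hσ2 : 1 + σ ^ p ≤ 2 ^ p := by
    have h := Real.rpow_le_rpow hσ hσp hp0.le
    rw [sigmaP, ← Real.rpow_mul (by linarith), one_div_mul_cancel hp0.ne', Real.rpow_one] at h
    linarith
  have hneg : -1 / p ≤ 0 := div_nonpos_of_nonpos_of_nonneg (by norm_num) hp0.le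
  have ha : 1 / 2 ≤ (1 + σ ^ p) ^ (-1 / p) := by
    have h := Real.rpow_le_rpow_of_nonpos hpos hσ2 hneg
    rwa [← Real.rpow_mul (by norm_num), mul_div_cancel₀ _ hp0.ne', Real.rpow_neg_one,
      ← one_div] at h
  have ha1 : (1 + σ ^ p) ^ (-1 / p) ≤ 1 :=
    Real.rpow_le_one_of_one_le_of_nonpos (by linarith [Real.rpow_nonneg hσ p]) hneg
  have h := normalized_rpow_add hp hσ
  have h₁ : Acoef p σ 0 ^ p ≤ ((1 + σ ^ p) ^ (-1 / p)) ^ p := by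
    refine Real.rpow_le_rpow ?_ ?_ hp0.le <;>
      simp only [Acoef, Real.zero_rpow hp0.ne', add_zero, Real.one_rpow] <;> linarith
  have h₂ : Bcoef p σ 0 = σ * (1 + σ ^ p) ^ (-1 / p) := by simp [Bcoef]
  rw [h₂]
  linarith

theorem one_le_distance_tau {p σ τ : ℝ} (hp : 1 < p) (hσ : 1 ≤ σ) (hτ : 0 ≤ τ) (hτ1 : τ < 1)
    (heq : 2 * (1 - τ) ^ p = 1 + τ ^ p) : 1 ≤ Acoef p σ τ ^ p + Bcoef p σ τ ^ p := by
  have hp0 : 0 < p := by linarith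
  have hpos := one_add_rpow_pos (p := p) hτ
  have hc := Real.rpow_nonneg hpos.le (-1 / p)
  have key : (1 - τ) * (1 + τ ^ p) ^ (-1 / p) = (2 : ℝ) ^ (-1 / p) := by
    have h1 : 0 < 1 - τ := by linarith
    rw [← heq, Real.mul_rpow (by norm_num) (Real.rpow_nonneg h1.le _), ← Real.rpow_mul h1.le,
      mul_div_cancel₀ _ hp0.ne', Real.rpow_neg_one]
    field_simp
  have hmono : (1 + σ ^ p) ^ (-1 / p) ≤ (2 : ℝ) ^ (-1 / p) ∧
      (2 : ℝ) ^ (-1 / p) ≤ σ * (1 + σ ^ p) ^ (-1 / p) := by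
    have e : (1 : ℝ) + 1 ^ p = 2 := by rw [Real.one_rpow]; norm_num
    rcases hσ.eq_or_lt with h | h
    · rw [← h, e, one_mul]
      exact ⟨le_rfl, le_rfl⟩
    · have h₁ := normalized_fst_lt hp zero_le_one h
      have h₂ := normalized_snd_lt hp zero_le_one h
      rw [e] at h₁ h₂
      rw [one_mul] at h₂
      exact ⟨h₁.le, h₂.le⟩
  have hA := Real.rpow_le_rpow (mul_nonneg hτ hc)
    (show τ * (1 + τ ^ p) ^ (-1 / p) ≤ Acoef p σ τ by
      simp only [Acoef]
      linarith [hmono.1]) hp0.le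
  have hB := Real.rpow_le_rpow hc
    (show (1 + τ ^ p) ^ (-1 / p) ≤ Bcoef p σ τ by
      simp only [Bcoef]
      linarith [hmono.2]) hp0.le
  linarith [normalized_rpow_add hp hτ]

/-- For every real `p > 1` and every `σ ∈ [1, σ_p]`, there is a unique
`τ ∈ [0, τ_p]` with `A^p + B^p = 1`. -/
theorem stmt_3 (p : ℝ) (hp : 1 < p) (τp : ℝ)
    (hτp : 0 ≤ τp ∧ τp < 1 ∧ 2 * (1 - τp) ^ p = 1 + τp ^ p)
    (σ : ℝ) (hσ : 1 ≤ σ ∧ σ ≤ sigmaP p) :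
    ∃! τ : ℝ, 0 ≤ τ ∧ τ ≤ τp ∧ Acoef p σ τ ^ p + Bcoef p σ τ ^ p = 1 := by
  obtain ⟨hτ0, hτ1, heq⟩ := hτp
  obtain ⟨hσ1, hσp⟩ := hσ
  have hσ0 : 0 < σ := by linarith
  obtain ⟨τ, ⟨h0, h1⟩, hτ⟩ := intermediate_value_Icc hτ0
    ((distance_continuousOn (σ := σ) hp).mono Set.Icc_subset_Ici_self)
    ⟨distance_zero_le_one hp hσ0.le hσp, one_le_distance_tau hp hσ1 hτ0 hτ1 heq⟩
  refine ⟨τ, ⟨h0, h1, hτ⟩, ?_⟩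
  rintro t ⟨ht0, ht1, ht⟩
  exact (distance_strictMonoOn hp hσ0).injOn ⟨ht0, by linarith⟩ ⟨h0, by linarith⟩
    (ht.trans hτ.symm)
end

section
/- For every real p > 1, Δ(p,1) = 4^{-1/p}(1 + τ_p)/(1 - τ_p). -/
/-- Increments of `x ↦ x ^ p` of a fixed length are strictly increasing when `1 < p`. -/
lemma rpow_add_sub_rpow_lt {p x y c : ℝ} (hp : 1 < p) (hx : 0 ≤ x) (hxy : x < y) (hc : 0 < c) :
    (x + c) ^ p - x ^ p < (y + c) ^ p - y ^ p := by
  have hd : 0 < y - x + c := by linarith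
  have ha : 0 < (y - x) / (y - x + c) := div_pos (by linarith) hd
  have hb : 0 < c / (y - x + c) := div_pos hc hd
  have hab : (y - x) / (y - x + c) + c / (y - x + c) = 1 := by field_simp
  have hx' : x ∈ Set.Ici (0 : ℝ) := hx
  have hy' : y + c ∈ Set.Ici (0 : ℝ) := by simp only [Set.mem_Ici]; linarith
  have hne : x ≠ y + c := by linarith
  have h₁ := (strictConvexOn_rpow hp).2 hx' hy' hne ha hb hab
  have h₂ := (strictConvexOn_rpow hp).2 hx' hy' hne hb ha (by linarith)
  simp only [smul_eq_mul] at h₁ h₂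
  rw [show (y - x) / (y - x + c) * x + c / (y - x + c) * (y + c) = x + c by
    field_simp; ring] at h₁
  rw [show c / (y - x + c) * x + (y - x) / (y - x + c) * (y + c) = y by
    field_simp; ring] at h₂
  set a := (y - x) / (y - x + c)
  set b := c / (y - x + c)
  have hsum : a * x ^ p + b * (y + c) ^ p + (b * x ^ p + a * (y + c) ^ p)
      = x ^ p + (y + c) ^ p := by
    linear_combination (x ^ p + (y + c) ^ p) * hab
  linarith

/-- On the `ℓ^p` unit circle, `(u, v) ↦ (u - c, v + c)` returns to the circle for at most one
point with `c ≤ u` and `0 ≤ v`. -/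
lemma shift_on_circle_not_lt {p u v u' v' c : ℝ} (hp : 1 < p) (hc : 0 < c) (hu' : c ≤ u')
    (hv : 0 ≤ v) (hv' : 0 ≤ v') (huv : u ^ p + v ^ p = 1) (huv' : u' ^ p + v' ^ p = 1)
    (h : (u - c) ^ p + (v + c) ^ p = 1) (h' : (u' - c) ^ p + (v' + c) ^ p = 1) :
    ¬ u' < u := by
  intro hlt
  have hG := rpow_add_sub_rpow_lt (x := u' - c) (y := u - c) hp (by linarith) (by linarith) hc
  simp only [sub_add_cancel] at hG
  have hpow : u' ^ p < u ^ p := Real.rpow_lt_rpow (by linarith) hlt (by linarith)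
  have hvv : v < v' := by
    by_contra hcon
    have := Real.rpow_le_rpow hv' (not_lt.mp hcon) (by linarith : 0 ≤ p)
    linarith
  have hH := rpow_add_sub_rpow_lt hp hv hvv hc
  linarith

/-- The point `(1, τ)` scaled by `(1 + τ^p)^{-1/p}` lies on the `ℓ^p` unit circle. -/
lemma normalized_mem_circle {p τ : ℝ} (hp : 0 < p) (hτ : 0 ≤ τ) :
    ((1 + τ ^ p) ^ (-1 / p)) ^ p + (τ * (1 + τ ^ p) ^ (-1 / p)) ^ p = 1 := by
  have hpos : 0 < 1 + τ ^ p := by positivity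
  rw [Real.mul_rpow hτ (by positivity), ← Real.rpow_mul hpos.le, div_mul_cancel₀ _ hp.ne',
    Real.rpow_neg_one]
  field_simp

/-- At `τ = τ_p` the normalizing factor is `2^{-1/p} / (1 - τ_p)`. -/
lemma normalizer_eq {p τ : ℝ} (hp : 0 < p) (hτ : τ < 1) (h : 2 * (1 - τ) ^ p = 1 + τ ^ p) :
    (1 + τ ^ p) ^ (-1 / p) = 2 ^ (-1 / p) / (1 - τ) := by
  have h1 : 0 < 1 - τ := by linarith
  rw [← h, Real.mul_rpow (by norm_num) (by positivity), ← Real.rpow_mul h1.le,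
    mul_div_cancel₀ _ hp.ne', Real.rpow_neg_one, ← div_eq_mul_inv]

/-- `τ_p` solves the equation `A^p + B^p = 1` at `σ = 1`. -/
lemma Acoef_rpow_add_Bcoef_rpow_eq_one {p τ : ℝ} (hp : 0 < p) (hτ0 : 0 ≤ τ) (hτ : τ < 1)
    (h : 2 * (1 - τ) ^ p = 1 + τ ^ p) : Acoef p 1 τ ^ p + Bcoef p 1 τ ^ p = 1 := by
  have h1 : 0 < 1 - τ := by linarith
  have hA : Acoef p 1 τ = τ * (1 + τ ^ p) ^ (-1 / p) := by
    rw [Acoef, normalizer_eq hp hτ h, Real.one_rpow, one_add_one_eq_two]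
    field_simp
    ring
  have hB : Bcoef p 1 τ = (1 + τ ^ p) ^ (-1 / p) := by
    rw [Bcoef, normalizer_eq hp hτ h, Real.one_rpow, one_add_one_eq_two]
    field_simp
    ring
  rw [hA, hB, add_comm]
  exact normalized_mem_circle hp hτ0

/-- For every real `p > 1`, `Δ(p,1) = 4^{-1/p} (1 + τ_p)/(1 - τ_p)`,
where `τ1 = τ(p,1)` is the value of the implicit function at `σ = 1`. -/
theorem stmt_5 (p : ℝ) (hp : 1 < p) (τp : ℝ)
    (hτp : 0 ≤ τp ∧ τp < 1 ∧ 2 * (1 - τp) ^ p = 1 + τp ^ p)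
    (τ1 : ℝ)
    (hτ1 : 0 ≤ τ1 ∧ τ1 ≤ τp ∧ Acoef p 1 τ1 ^ p + Bcoef p 1 τ1 ^ p = 1) :
    (τ1 + 1) * (1 + τ1 ^ p) ^ (-1 / p) * (1 + (1 : ℝ) ^ p) ^ (-1 / p)
      = 4 ^ (-1 / p) * (1 + τp) / (1 - τp) := by
  obtain ⟨h0, hlt, h⟩ := hτp
  obtain ⟨h10, hle, h1⟩ := hτ1
  have hp0 : 0 < p := by linarith
  have hpos : 0 < 1 - τp := by linarith
  have hu := normalizer_eq hp0 hlt h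
  have hc : (0 : ℝ) < 2 ^ (-1 / p) := by positivity
  have heq : τ1 = τp := by
    by_contra hne
    have hlt1 : τ1 < τp := lt_of_le_of_ne hle hne
    have hsol := Acoef_rpow_add_Bcoef_rpow_eq_one hp0 h0 hlt h
    simp only [Acoef, Bcoef, Real.one_rpow, one_add_one_eq_two, one_mul] at h1 hsol
    rw [add_comm (2 ^ (-1 / p) : ℝ)] at h1 hsol
    refine shift_on_circle_not_lt hp hc ?_ (by positivity) (by positivity)
      (normalized_mem_circle hp0 h10) (normalized_mem_circle hp0 h0) h1 hsol ?_
    · rw [hu, le_div_iff₀ hpos]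
      nlinarith
    · have hpow : τ1 ^ p < τp ^ p := Real.rpow_lt_rpow h10 hlt1 hp0
      exact Real.rpow_lt_rpow_of_neg (by positivity) (by linarith)
        (div_neg_of_neg_of_pos (by norm_num) hp0)
  have h4 : (4 : ℝ) ^ (-1 / p) = 2 ^ (-1 / p) * 2 ^ (-1 / p) := by
    rw [← Real.mul_rpow (by norm_num) (by norm_num)]
    norm_num
  rw [heq, hu, h4, Real.one_rpow, one_add_one_eq_two]
  ring
end

section
/- For every real p > 1, the partial derivative of Δ(p,σ) with respect to σ vanishes at both endpoints σ = 1 and σ = σ_p, i.e. ∂Δ(p,σ)/∂σ|_{σ=1} = ∂Δ(p,σ)/∂σ|_{σ=σ_p} = 0. -/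
/-- Given the branch `T : σ ↦ τ(p,σ)`, the Minkowski–Cohn function
`Δ(p,σ) = (τ(p,σ) + σ)(1 + τ(p,σ)^p)^{-1/p}(1 + σ^p)^{-1/p}`. -/
noncomputable def DeltaFun (p : ℝ) (T : ℝ → ℝ) (σ : ℝ) : ℝ :=
  (T σ + σ) * (1 + T σ ^ p) ^ (-1 / p) * (1 + σ ^ p) ^ (-1 / p)

open Filter Topology Set

/-- A continuous curve `t = T s` lying on a level set of `F`, along which `F` is differentiable with
nonzero partial derivative in `t`, is differentiable. -/
lemma hasDerivWithinAt_of_levelSet {F : ℝ × ℝ → ℝ} {T : ℝ → ℝ} {S : Set ℝ} {s fs ft : ℝ}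
    (hF : HasFDerivAt F (fs • ContinuousLinearMap.fst ℝ ℝ ℝ + ft • ContinuousLinearMap.snd ℝ ℝ ℝ)
      (s, T s))
    (hft : ft ≠ 0) (hT : ContinuousWithinAt T S s) (hlevel : ∀ r ∈ S, F (r, T r) = F (s, T s)) :
    HasDerivWithinAt T (-fs / ft) S s := by
  rw [hasDerivWithinAt_iff_isLittleO, Asymptotics.isLittleO_iff]
  intro c hc
  have htend : Tendsto (fun r => (r, T r)) (𝓝[S] s) (𝓝 (s, T s)) :=
    (tendsto_nhdsWithin_of_tendsto_nhds tendsto_id).prodMk_nhds hT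
  have hpos : 0 < |ft| := abs_pos.2 hft
  set k := fs / ft with hk
  set c' := min (|ft| / 2) (c * |ft| / (2 * (1 + |k|))) with hc'
  have hk0 : 0 < 1 + |k| := by positivity
  have hc'0 : 0 < c' := lt_min (by positivity) (by positivity)
  have h1 : c' ≤ |ft| / 2 := min_le_left _ _
  have h2 : c' * (1 + |k|) ≤ c * |ft| / 2 := by
    have : c' ≤ c * |ft| / (2 * (1 + |k|)) := min_le_right _ _
    rw [le_div_iff₀ (by positivity)] at this
    linarith
  have hlo := (Asymptotics.isLittleO_iff.1 (hasFDerivAt_iff_isLittleO.1 hF)) hc'0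
  filter_upwards [htend.eventually hlo, self_mem_nhdsWithin] with r hr hrS
  rw [hlevel r hrS] at hr
  have hlin : F (s, T s) - F (s, T s) - (fs • ContinuousLinearMap.fst ℝ ℝ ℝ +
      ft • ContinuousLinearMap.snd ℝ ℝ ℝ) ((r, T r) - (s, T s)) =
      -(ft * (T r - T s + k * (r - s))) := by
    simp [hk]
    field_simp
    ring
  rw [hlin, norm_neg, norm_mul, Prod.norm_def] at hr
  simp only [Real.norm_eq_abs, Prod.fst_sub, Prod.snd_sub] at hr
  have he : T r - T s - (r - s) • (-fs / ft) = T r - T s + k * (r - s) := by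
    simp [hk]; ring
  rw [he, Real.norm_eq_abs, Real.norm_eq_abs]
  set e := T r - T s + k * (r - s)
  have hd : |T r - T s| ≤ |e| + |k| * |r - s| := by
    have : T r - T s = e - k * (r - s) := by simp [e]
    rw [this, ← abs_mul]
    exact abs_sub _ _
  have hmax : max |r - s| |T r - T s| ≤ |e| + (1 + |k|) * |r - s| := by
    have := abs_nonneg e
    have h3 : 0 ≤ |k| * |r - s| := by positivity
    have := abs_nonneg (r - s)
    apply max_le <;> linarith
  have h4 : |ft| * |e| ≤ c' * |e| + c' * (1 + |k|) * |r - s| := by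
    calc |ft| * |e| ≤ c' * (|e| + (1 + |k|) * |r - s|) :=
          hr.trans (mul_le_mul_of_nonneg_left hmax hc'0.le)
      _ = _ := by ring
  have h5 : c' * |e| ≤ |ft| / 2 * |e| := mul_le_mul_of_nonneg_right h1 (abs_nonneg _)
  have h6 := mul_le_mul_of_nonneg_right h2 (abs_nonneg (r - s))
  have h7 : |ft| * |e| ≤ |ft| * (c * |r - s|) := by linarith
  exact le_of_mul_le_mul_left h7 hpos

namespace MinkowskiCohn

/-- The abscissa of the point of slope `t` on the curve `x ^ p + y ^ p = 1`. -/
noncomputable def absc (p t : ℝ) : ℝ := (1 + t ^ p) ^ (-1 / p)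

/-- The `p`-th power of the `ℓ^p` norm of the sum of the two points. -/
noncomputable def level (p : ℝ) (z : ℝ × ℝ) : ℝ := Acoef p z.1 z.2 ^ p + Bcoef p z.1 z.2 ^ p

/-- The partial derivative of `level` in the first variable. -/
noncomputable def levelFst (p σ τ : ℝ) : ℝ :=
  p * absc p σ ^ (p + 1) * (Bcoef p σ τ ^ (p - 1) + Acoef p σ τ ^ (p - 1) * σ ^ (p - 1))

/-- The partial derivative of `level` in the second variable. -/
noncomputable def levelSnd (p σ τ : ℝ) : ℝ :=
  p * absc p τ ^ (p + 1) * (Bcoef p σ τ ^ (p - 1) - Acoef p σ τ ^ (p - 1) * τ ^ (p - 1))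

variable {p σ τ t : ℝ}

lemma absc_pos (ht : 0 ≤ t) : 0 < absc p t := by
  have := Real.rpow_nonneg ht p
  exact Real.rpow_pos_of_pos (by linarith) _

lemma absc_rpow_mul (hp : 1 < p) (ht : 0 ≤ t) : absc p t ^ p * (1 + t ^ p) = 1 := by
  have := Real.rpow_nonneg ht p
  have h : (0 : ℝ) < 1 + t ^ p := by linarith
  rw [absc, ← Real.rpow_mul h.le, div_mul_cancel₀ _ (by linarith), Real.rpow_neg_one,
    inv_mul_cancel₀ h.ne']

lemma hasDerivAt_absc (hp : 1 < p) (ht : 0 ≤ t) :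
    HasDerivAt (absc p) (-(t ^ (p - 1) * absc p t ^ (p + 1))) t := by
  have h0 := Real.rpow_nonneg ht p
  have h : (0 : ℝ) < 1 + t ^ p := by linarith
  have hp0 : p ≠ 0 := by linarith
  have h1 := ((Real.hasDerivAt_rpow_const (x := t) (Or.inr hp.le)).const_add 1).rpow_const
    (p := -1 / p) (Or.inl h.ne')
  have h2 : absc p t ^ (p + 1) = (1 + t ^ p) ^ (-1 / p - 1) := by
    rw [absc, ← Real.rpow_mul h.le]
    congr 1
    field_simp
    ring
  refine h1.congr_deriv ?_
  rw [h2]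
  field_simp

lemma hasDerivAt_mul_absc (hp : 1 < p) (ht : 0 ≤ t) :
    HasDerivAt (fun t => t * absc p t) (absc p t ^ (p + 1)) t := by
  refine ((hasDerivAt_id t).mul (hasDerivAt_absc hp ht)).congr_deriv ?_
  have h := absc_rpow_mul hp ht
  have hx := absc_pos (p := p) ht
  have h1 : absc p t ^ (p + 1) = absc p t ^ p * absc p t := Real.rpow_add_one hx.ne' _
  have h2 : t * t ^ (p - 1) = t ^ p := by
    rw [mul_comm, ← Real.rpow_add_one' ht (by linarith), sub_add_cancel]
  simp only [id]
  rw [h1]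
  linear_combination -absc p t * h - absc p t ^ p * absc p t * h2

lemma hasFDerivAt_level (hp : 1 < p) (hσ : 0 ≤ σ) (hτ : 0 ≤ τ) :
    HasFDerivAt (level p) (levelFst p σ τ • ContinuousLinearMap.fst ℝ ℝ ℝ +
      levelSnd p σ τ • ContinuousLinearMap.snd ℝ ℝ ℝ) (σ, τ) := by
  have hfst : HasFDerivAt Prod.fst (ContinuousLinearMap.fst ℝ ℝ ℝ) (σ, τ) := hasFDerivAt_fst
  have hsnd : HasFDerivAt Prod.snd (ContinuousLinearMap.snd ℝ ℝ ℝ) (σ, τ) := hasFDerivAt_snd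
  have x1 := (hasDerivAt_absc (t := (σ, τ).2) hp hτ).comp_hasFDerivAt (σ, τ) hsnd
  have x2 := (hasDerivAt_absc (t := (σ, τ).1) hp hσ).comp_hasFDerivAt (σ, τ) hfst
  have y1 := (hasDerivAt_mul_absc (t := (σ, τ).2) hp hτ).comp_hasFDerivAt (σ, τ) hsnd
  have y2 := (hasDerivAt_mul_absc (t := (σ, τ).1) hp hσ).comp_hasFDerivAt (σ, τ) hfst
  have hA := (x1.sub x2).rpow_const (p := p) (Or.inr hp.le)
  have hB := (y2.add y1).rpow_const (p := p) (Or.inr hp.le)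
  refine (hA.add hB).congr_fderiv ?_
  ext <;> simp [levelFst, levelSnd, Acoef, Bcoef, absc] <;> ring

lemma absc_lt_absc (hp : 1 < p) (hτ : 0 ≤ τ) (h : τ < σ) : absc p σ < absc p τ := by
  have h1 := Real.rpow_lt_rpow hτ h (by linarith : 0 < p)
  have h0 := Real.rpow_nonneg hτ p
  exact Real.rpow_lt_rpow_of_neg (by linarith) (by linarith)
    (div_neg_of_neg_of_pos (by norm_num) (by linarith))

lemma levelSnd_pos (hp : 1 < p) (hτ : 0 ≤ τ) (h : τ < σ) : 0 < levelSnd p σ τ := by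
  have hA : 0 < Acoef p σ τ := sub_pos.2 (absc_lt_absc hp hτ h)
  have hx := absc_pos (p := p) hτ
  have hs := absc_pos (p := p) (hτ.trans h.le)
  have hAB : Acoef p σ τ * τ < Bcoef p σ τ := by
    change (absc p τ - absc p σ) * τ < σ * absc p σ + τ * absc p τ
    nlinarith [mul_pos (lt_of_le_of_lt hτ h) hs, mul_nonneg hτ hs.le]
  have := Real.rpow_lt_rpow (mul_nonneg hA.le hτ) hAB (by linarith : 0 < p - 1)
  rw [Real.mul_rpow hA.le hτ] at this
  exact mul_pos (mul_pos (by linarith) (Real.rpow_pos_of_pos hx _)) (sub_pos.2 this)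

lemma strictMonoOn_level (hp : 1 < p) (h : τ < σ) (hσ : 0 ≤ σ) :
    StrictMonoOn (fun t => level p (σ, t)) (Icc 0 τ) := by
  have hder : ∀ t, 0 ≤ t → HasDerivAt (fun t => level p (σ, t)) (levelSnd p σ t) t := by
    intro t ht
    have h1 : HasDerivAt (fun t : ℝ => (σ, t)) ((0 : ℝ), (1 : ℝ)) t :=
      (hasDerivAt_const t σ).prodMk (hasDerivAt_id t)
    refine ((hasFDerivAt_level hp hσ ht).comp_hasDerivAt t h1).congr_deriv ?_
    simp
  refine strictMonoOn_of_deriv_pos (convex_Icc 0 τ)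
    (fun t ht => (hder t ht.1).continuousAt.continuousWithinAt) fun t ht => ?_
  rw [interior_Icc] at ht
  rw [(hder t ht.1.le).deriv]
  exact levelSnd_pos hp ht.1.le (ht.2.trans h)

/-- The derivative of `Δ` vanishes wherever its gradient is parallel to that of `level`. -/
lemma hasDerivWithinAt_deltaFun {S : Set ℝ} {T : ℝ → ℝ} {τp : ℝ} (hp : 1 < p) (hτp : τp < 1)
    (hS : ∀ s ∈ S, 1 ≤ s)
    (hT : ∀ s ∈ S, T s ∈ Icc 0 τp ∧ level p (s, T s) = 1)
    (hσ : σ ∈ S) (hτ : τ ∈ Icc 0 τp) (hlevel : level p (σ, τ) = 1)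
    (hpar : (absc p τ - σ ^ (p - 1) * (τ * absc p τ)) *
        (Bcoef p σ τ ^ (p - 1) - Acoef p σ τ ^ (p - 1) * τ ^ (p - 1)) =
      (absc p σ - τ ^ (p - 1) * (σ * absc p σ)) *
        (Bcoef p σ τ ^ (p - 1) + Acoef p σ τ ^ (p - 1) * σ ^ (p - 1))) :
    HasDerivWithinAt (DeltaFun p T) 0 S σ := by
  have hmono : ∀ s ∈ S, StrictMonoOn (fun t => level p (s, t)) (Icc 0 τp) := fun s hs =>
    strictMonoOn_level hp (hτp.trans_le (hS s hs)) (zero_le_one.trans (hS s hs))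
  have hTσ : T σ = τ :=
    (hmono σ hσ).injOn (hT σ hσ).1 hτ ((hT σ hσ).2.trans hlevel.symm)
  have hσ0 : 0 ≤ σ := zero_le_one.trans (hS σ hσ)
  have hcont : ∀ a, 0 ≤ a → ContinuousWithinAt (fun s => level p (s, a)) S σ := fun a ha =>
    ((hasFDerivAt_level hp hσ0 ha).continuousAt.comp (f := fun s : ℝ => (s, a))
      (by fun_prop)).continuousWithinAt
  have hTcont : ContinuousWithinAt T S σ := by
    rw [ContinuousWithinAt, hTσ, tendsto_order]
    refine ⟨fun a ha => ?_, fun a ha => ?_⟩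
    · rcases lt_or_ge a 0 with h0 | h0
      · filter_upwards [self_mem_nhdsWithin] with s hs using h0.trans_le (hT s hs).1.1
      · have haI : a ∈ Icc 0 τp := ⟨h0, ha.le.trans hτ.2⟩
        have hlt : level p (σ, a) < 1 := hlevel ▸ hmono σ hσ haI hτ ha
        filter_upwards [(hcont a h0).eventually_lt_const hlt, self_mem_nhdsWithin] with s h1 hs
        exact ((hmono s hs).lt_iff_lt haI (hT s hs).1).1 (h1.trans_eq (hT s hs).2.symm)
    · rcases lt_or_ge τp a with h0 | h0
      · filter_upwards [self_mem_nhdsWithin] with s hs using (hT s hs).1.2.trans_lt h0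
      · have haI : a ∈ Icc 0 τp := ⟨hτ.1.trans ha.le, h0⟩
        have hlt : 1 < level p (σ, a) := hlevel ▸ hmono σ hσ hτ haI ha
        filter_upwards [(hcont a haI.1).eventually_const_lt hlt, self_mem_nhdsWithin] with s h1 hs
        exact ((hmono s hs).lt_iff_lt (hT s hs).1 haI).1 ((hT s hs).2.trans_lt h1)
  have hsnd := levelSnd_pos hp hτ.1 (hτ.2.trans_lt (hτp.trans_le (hS σ hσ)))
  have hT' : HasDerivWithinAt T (-levelFst p σ τ / levelSnd p σ τ) S σ :=
    hasDerivWithinAt_of_levelSet (F := level p) (by rw [hTσ]; exact hasFDerivAt_level hp hσ0 hτ.1)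
      hsnd.ne' hTcont fun r hr => (hT r hr).2.trans (hT σ hσ).2.symm
  have x1 := (hTσ.symm ▸ hasDerivAt_absc hp hτ.1 : HasDerivAt (absc p) _ (T σ)).comp_hasDerivWithinAt
    σ hT'
  have y1 := (hTσ.symm ▸ hasDerivAt_mul_absc hp hτ.1 :
    HasDerivAt (fun t => t * absc p t) _ (T σ)).comp_hasDerivWithinAt σ hT'
  have x2 := (hasDerivAt_absc hp hσ0).hasDerivWithinAt (s := S)
  have y2 := (hasDerivAt_mul_absc hp hσ0).hasDerivWithinAt (s := S)
  have hΔ : DeltaFun p T = (absc p ∘ T) * (fun t => t * absc p t) +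
      absc p * ((fun t => t * absc p t) ∘ T) := by
    funext s
    simp only [DeltaFun, absc, Pi.add_apply, Pi.mul_apply, Function.comp]
    ring
  rw [hΔ]
  refine ((x1.mul y2).add (x2.mul y1)).congr_deriv ?_
  simp only [Function.comp, hTσ]
  have h0 : levelSnd p σ τ ≠ 0 := hsnd.ne'
  field_simp
  simp only [levelFst, levelSnd]
  linear_combination absc p σ ^ (p + 1) * p * absc p τ ^ (p + 1) * hpar

lemma one_le_sigmaP (hp : 1 < p) : 1 ≤ sigmaP p := by
  have : (2 : ℝ) ^ (1 : ℝ) ≤ 2 ^ p := Real.rpow_le_rpow_of_exponent_le (by norm_num) hp.le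
  rw [Real.rpow_one] at this
  exact Real.one_le_rpow (by linarith) (by positivity)

lemma absc_zero (hp : 1 < p) : absc p 0 = 1 := by
  simp [absc, Real.zero_rpow (by linarith : p ≠ 0)]

lemma absc_sigmaP (hp : 1 < p) : absc p (sigmaP p) = 1 / 2 := by
  have h2 : (1 : ℝ) ≤ 2 ^ p := Real.one_le_rpow (by norm_num) (by linarith)
  have hp0 : p ≠ 0 := by linarith
  rw [absc, sigmaP, ← Real.rpow_mul (by linarith), one_div_mul_cancel hp0, Real.rpow_one,
    add_sub_cancel, ← Real.rpow_mul (by norm_num), mul_div_cancel₀ _ hp0, Real.rpow_neg_one]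
  norm_num

lemma absc_one_eq (hp : 1 < p) (hτ : τ < 1) (h : 2 * (1 - τ) ^ p = 1 + τ ^ p) :
    absc p 1 = absc p τ - τ * absc p τ := by
  have h1 : 0 < 1 - τ := by linarith
  have hp0 : p ≠ 0 := by linarith
  have h2 : absc p τ = absc p 1 * (1 - τ)⁻¹ := by
    rw [absc, absc, ← h, Real.mul_rpow (by norm_num) (by positivity), ← Real.rpow_mul h1.le,
      mul_div_cancel₀ _ hp0, Real.rpow_neg_one, Real.one_rpow]
    norm_num
  rw [h2]
  field_simp

end MinkowskiCohn

open MinkowskiCohn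

/-- **Lemma 1.** For every real `p > 1`, the (one-sided) derivative of
`Δ(p,σ)` with respect to `σ` vanishes at both endpoints `σ = 1` and `σ = σ_p`. -/
theorem stmt_7 (p : ℝ) (hp : 1 < p) (τp : ℝ)
    (hτp : 0 ≤ τp ∧ τp < 1 ∧ 2 * (1 - τp) ^ p = 1 + τp ^ p)
    (T : ℝ → ℝ)
    (hT : ∀ σ ∈ Set.Icc 1 (sigmaP p),
      0 ≤ T σ ∧ T σ ≤ τp ∧ Acoef p σ (T σ) ^ p + Bcoef p σ (T σ) ^ p = 1) :
    HasDerivWithinAt (DeltaFun p T) 0 (Set.Icc 1 (sigmaP p)) 1 ∧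
    HasDerivWithinAt (DeltaFun p T) 0 (Set.Icc 1 (sigmaP p)) (sigmaP p) := by
  obtain ⟨hτ0, hτ1, hτ⟩ := hτp
  have hσ := one_le_sigmaP hp
  have hp0 : p ≠ 0 := by linarith
  have hp1 : p - 1 ≠ 0 := by linarith
  have hS : ∀ s ∈ Set.Icc 1 (sigmaP p), 1 ≤ s := fun s hs => hs.1
  have hT' : ∀ s ∈ Set.Icc 1 (sigmaP p), T s ∈ Set.Icc 0 τp ∧ level p (s, T s) = 1 :=
    fun s hs => ⟨⟨(hT s hs).1, (hT s hs).2.1⟩, (hT s hs).2.2⟩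
  constructor
  · have hone := absc_one_eq hp hτ1 hτ
    have hx := absc_pos (p := p) hτ0
    have hA : Acoef p 1 τp = absc p τp * τp := by
      change absc p τp - absc p 1 = _
      rw [hone]; ring
    have hB : Bcoef p 1 τp = absc p τp := by
      change 1 * absc p 1 + τp * absc p τp = _
      rw [hone]; ring
    refine hasDerivWithinAt_deltaFun hp hτ1 hS hT' ⟨le_rfl, hσ⟩ ⟨hτ0, le_rfl⟩ ?_ ?_
    · simp only [level, hA, hB]
      rw [Real.mul_rpow hx.le hτ0]
      linear_combination absc_rpow_mul hp hτ0
    · rw [hA, hB, hone, Real.mul_rpow hx.le hτ0, Real.one_rpow]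
      ring
  · have hs := absc_sigmaP hp
    have hz := absc_zero hp
    have hσ0 : 0 ≤ sigmaP p := by linarith
    have hA : Acoef p (sigmaP p) 0 = 1 / 2 := by
      change absc p 0 - absc p (sigmaP p) = _
      rw [hs, hz]; norm_num
    have hB : Bcoef p (sigmaP p) 0 = sigmaP p * (1 / 2) := by
      change sigmaP p * absc p (sigmaP p) + 0 * absc p 0 = _
      rw [hs]; ring
    refine hasDerivWithinAt_deltaFun hp hτ1 hS hT' ⟨hσ, le_rfl⟩ ⟨le_rfl, hτ0⟩ ?_ ?_
    · simp only [level, hA, hB]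
      rw [Real.mul_rpow hσ0 (by norm_num), ← hs]
      linear_combination absc_rpow_mul hp hσ0
    · rw [hA, hB, hs, hz, Real.zero_rpow hp1, Real.mul_rpow hσ0 (by norm_num)]
      ring
end

section
/- For every real p > 1 and every σ with 1 ≤ σ ≤ σ_p, one has B(p,σ)^{p-1} - τ(p,σ)^{p-1} A(p,σ)^{p-1} > 0; consequently, the sign of ∂Δ(p,σ)/∂σ is the opposite of the sign of g(p,σ) := -(1 + σ^p)^{1 + 1/p}(B(p,σ)^{p-1} - τ(p,σ)^{p-1} A(p,σ)^{p-1}) ∂Δ(p,σ)/∂σ. -/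
/-- Given the branch `T : σ ↦ τ(p,σ)`, the function
`g(p,σ) = -(1 + σ^p)^{1 + 1/p} (B^{p-1} - τ^{p-1} A^{p-1}) ∂Δ(p,σ)/∂σ`. -/
noncomputable def gFun (p : ℝ) (T : ℝ → ℝ) (σ : ℝ) : ℝ :=
  -(1 + σ ^ p) ^ (1 + 1 / p) *
    (Bcoef p σ (T σ) ^ (p - 1) - T σ ^ (p - 1) * Acoef p σ (T σ) ^ (p - 1)) *
    derivWithin (DeltaFun p T) (Set.Icc 1 (sigmaP p)) σ

lemma Real.sign_pos_mul {c : ℝ} (hc : 0 < c) (x : ℝ) : Real.sign (c * x) = Real.sign x := by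
  rcases lt_trichotomy x 0 with h | rfl | h
  · rw [Real.sign_of_neg h, Real.sign_of_neg (mul_neg_of_pos_of_neg hc h)]
  · rw [mul_zero]
  · rw [Real.sign_of_pos h, Real.sign_of_pos (mul_pos hc h)]

lemma Acoef_nonneg {p σ τ : ℝ} (hp : 0 < p) (hτ : 0 ≤ τ) (hτσ : τ ≤ σ) : 0 ≤ Acoef p σ τ := by
  have hpow : τ ^ p ≤ σ ^ p := Real.rpow_le_rpow hτ hτσ hp.le
  have hτpow : 0 ≤ τ ^ p := Real.rpow_nonneg hτ p
  exact sub_nonneg.mpr (Real.rpow_le_rpow_of_nonpos (by linarith) (by linarith)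
    (div_nonpos_of_nonpos_of_nonneg (by norm_num) hp.le))

lemma mul_Acoef_lt_Bcoef {p σ τ : ℝ} (hτ : 0 ≤ τ) (hσ : 0 < σ) :
    τ * Acoef p σ τ < Bcoef p σ τ := by
  have hs : 0 < (1 + σ ^ p) ^ (-1 / p) := by positivity
  have hkey : 0 < (σ + τ) * (1 + σ ^ p) ^ (-1 / p) := by positivity
  unfold Acoef Bcoef
  linarith

/-- For every real `p > 1` and `σ ∈ [1, σ_p]`, one has
`B^{p-1} - τ^{p-1} A^{p-1} > 0`; consequently the sign of `∂Δ(p,σ)/∂σ` is the opposite of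
the sign of `g(p,σ)`. -/
theorem stmt_8 (p : ℝ) (hp : 1 < p) (τp : ℝ)
    (hτp : 0 ≤ τp ∧ τp < 1 ∧ 2 * (1 - τp) ^ p = 1 + τp ^ p)
    (T : ℝ → ℝ)
    (hT : ∀ σ ∈ Set.Icc 1 (sigmaP p),
      0 ≤ T σ ∧ T σ ≤ τp ∧ Acoef p σ (T σ) ^ p + Bcoef p σ (T σ) ^ p = 1)
    (σ : ℝ) (hσ : σ ∈ Set.Icc 1 (sigmaP p)) :
    0 < Bcoef p σ (T σ) ^ (p - 1) - T σ ^ (p - 1) * Acoef p σ (T σ) ^ (p - 1) ∧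
    Real.sign (derivWithin (DeltaFun p T) (Set.Icc 1 (sigmaP p)) σ)
      = -Real.sign (gFun p T σ) := by
  obtain ⟨hτ, hττp, -⟩ := hT σ hσ
  have hσ0 : 0 < σ := one_pos.trans_le hσ.1
  have hA : 0 ≤ Acoef p σ (T σ) := Acoef_nonneg (by linarith) hτ (by linarith [hτp.2.1, hσ.1])
  have hpos : 0 < Bcoef p σ (T σ) ^ (p - 1) - T σ ^ (p - 1) * Acoef p σ (T σ) ^ (p - 1) := by
    rw [← Real.mul_rpow hτ hA]
    exact sub_pos.mpr (Real.rpow_lt_rpow (mul_nonneg hτ hA) (mul_Acoef_lt_Bcoef hτ hσ0)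
      (sub_pos.mpr hp))
  refine ⟨hpos, ?_⟩
  have hfac : 0 < (1 + σ ^ p) ^ (1 + 1 / p) := by positivity
  rw [gFun, neg_mul, neg_mul, Real.sign_neg, neg_neg, Real.sign_pos_mul (mul_pos hfac hpos)]
end

section
/- For every real p ≥ 6 and every σ with 1 + 1.37/√p ≤ σ ≤ σ_p, one has Δ(p,σ) > Δ(p,1). -/
/-- Bernoulli's inequality in the form `u ^ p - t ^ p ≤ p u ^ (p - 1) (u - t)`, with `u ^ (p - 1)`
bounded by `1 / 2`. -/
lemma rpow_sub_rpow_le_of_le_half {p t u : ℝ} (hp : 2 ≤ p) (ht : 0 ≤ t) (htu : t ≤ u)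
    (hu : u ≤ 1 / 2) : u ^ p - t ^ p ≤ p * (u - t) / 2 := by
  rcases eq_or_lt_of_le (ht.trans htu) with h0 | hpos
  · obtain rfl : t = u := by linarith
    simp
  have hb := one_add_mul_self_le_rpow_one_add (s := t / u - 1)
    (by linarith [div_nonneg ht hpos.le]) (by linarith : 1 ≤ p)
  rw [show 1 + (t / u - 1) = t / u by ring, Real.div_rpow ht hpos.le,
    le_div_iff₀ (Real.rpow_pos_of_pos hpos p)] at hb
  have hsplit : u ^ p = u ^ (p - 1) * u := by
    rw [← Real.rpow_add_one hpos.ne']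
    ring_nf
  have hle : u ^ (p - 1) ≤ 1 / 2 := by
    calc u ^ (p - 1) ≤ u ^ (1 : ℝ) :=
          Real.rpow_le_rpow_of_exponent_ge hpos (by linarith) (by linarith)
      _ ≤ 1 / 2 := by simpa using hu
  have hexp : (1 + p * (t / u - 1)) * u ^ p = u ^ p - p * (u - t) * u ^ (p - 1) := by
    rw [hsplit]
    field_simp
    ring
  have hmul := mul_le_mul_of_nonneg_left hle
    (mul_nonneg (by linarith : 0 ≤ p) (sub_nonneg.2 htu))
  linarith

/-- The map `t ↦ (1 + t) (1 + t ^ p) ^ (-1 / p)` is monotone on `[0, 1 / 2]`. -/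
lemma one_add_mul_rpow_neg_mono {p t u : ℝ} (hp : 2 ≤ p) (ht : 0 ≤ t) (htu : t ≤ u)
    (hu : u ≤ 1 / 2) :
    (1 + t) * (1 + t ^ p) ^ (-1 / p) ≤ (1 + u) * (1 + u ^ p) ^ (-1 / p) := by
  have hp0 : 0 < p := by linarith
  have hu0 : 0 ≤ u := ht.trans htu
  have htp : 0 ≤ t ^ p := Real.rpow_nonneg ht p
  have hup : 0 ≤ u ^ p := Real.rpow_nonneg hu0 p
  have hpow : ∀ x : ℝ, 0 ≤ x → (x ^ (-1 / p)) ^ p = x⁻¹ := fun x hx => by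
    rw [← Real.rpow_mul hx, div_mul_cancel₀ _ hp0.ne', Real.rpow_neg_one]
  rw [← Real.rpow_le_rpow_iff (by positivity) (by positivity) hp0,
    Real.mul_rpow (by positivity) (by positivity), Real.mul_rpow (by positivity) (by positivity),
    hpow _ (by positivity), hpow _ (by positivity), ← div_eq_mul_inv, ← div_eq_mul_inv,
    div_le_div_iff₀ (by positivity) (by positivity)]
  have hb := one_add_mul_self_le_rpow_one_add (s := (u - t) / (1 + t))
    (by linarith [div_nonneg (sub_nonneg.2 htu) (by linarith : 0 ≤ 1 + t)])
    (by linarith : 1 ≤ p)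
  rw [show 1 + (u - t) / (1 + t) = (1 + u) / (1 + t) by field_simp; ring,
    Real.div_rpow (by positivity) (by positivity), le_div_iff₀ (by positivity)] at hb
  have hd : p * (u - t) / 2 ≤ p * ((u - t) / (1 + t)) := by
    rw [mul_div_assoc]
    gcongr
    linarith
  have hdiff := rpow_sub_rpow_le_of_le_half hp ht htu hu
  have hd0 : 0 ≤ p * ((u - t) / (1 + t)) :=
    mul_nonneg hp0.le (div_nonneg (sub_nonneg.2 htu) (by linarith))
  calc (1 + t) ^ p * (1 + u ^ p)
      ≤ (1 + t) ^ p * ((1 + p * ((u - t) / (1 + t))) * (1 + t ^ p)) := by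
        gcongr
        nlinarith [mul_nonneg hd0 htp]
    _ = (1 + p * ((u - t) / (1 + t))) * (1 + t) ^ p * (1 + t ^ p) := by ring
    _ ≤ (1 + u) ^ p * (1 + t ^ p) := by gcongr

/-- `p (1 - 2 ^ (-1 / p))` is at least `log 2 (1 - log 2 / 12) ≥ 0.653` for `p ≥ 6`. -/
lemma le_mul_one_sub_two_rpow {p : ℝ} (hp : 6 ≤ p) :
    0.653 ≤ p * (1 - (2 : ℝ) ^ (-1 / p)) := by
  have hp0 : 0 < p := by linarith
  have hl := Real.log_two_gt_d9
  have hl' := Real.log_two_lt_d9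
  set x := Real.log 2 / p with hx
  have hx0 : 0 < x := div_pos (by linarith) hp0
  have hpx : p * x = Real.log 2 := by rw [hx]; field_simp
  have hx6 : x ≤ 0.1156 := by
    rw [hx, div_le_iff₀ hp0]
    nlinarith
  have htwo : (2 : ℝ) ^ (-1 / p) = (Real.exp x)⁻¹ := by
    rw [Real.rpow_def_of_pos two_pos, ← Real.exp_neg, hx]
    ring_nf
  have hexp : (Real.exp x)⁻¹ ≤ 1 - x * (1 - x / 2) := by
    rw [inv_le_iff_one_le_mul₀ (Real.exp_pos x)]
    have hq := Real.quadratic_le_exp_of_nonneg hx0.le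
    have hf : 0 ≤ 1 - x * (1 - x / 2) := by nlinarith
    calc (1 : ℝ) ≤ (1 - x * (1 - x / 2)) * (1 + x + x ^ 2 / 2) := by nlinarith [sq_nonneg (x ^ 2)]
      _ ≤ _ := by gcongr
  rw [htwo]
  calc (0.653 : ℝ) ≤ Real.log 2 * (1 - x / 2) := by nlinarith
    _ = p * (x * (1 - x / 2)) := by rw [← hpx]; ring
    _ ≤ _ := by gcongr; linarith

/-- Growth of `(1 + 1.37 / √p) ^ p`: it is at least `14.3 (p / 6)` for `p ≥ 6`. -/
lemma mul_le_one_add_div_sqrt_rpow {p : ℝ} (hp : 6 ≤ p) :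
    14.3 * (p / 6) ≤ (1 + 1.37 / √p) ^ p := by
  set r := √p / √6 with hr
  have h6 : 0 < √(6 : ℝ) := by positivity
  have hsp : 0 < √p := Real.sqrt_pos.2 (by linarith)
  have hr1 : 1 ≤ r := by
    rw [hr, one_le_div h6]
    exact Real.sqrt_le_sqrt hp
  have hr2 : r ^ 2 = p / 6 := by
    rw [hr, div_pow, Real.sq_sqrt (by linarith), Real.sq_sqrt (by norm_num)]
  have hs6 : √(6 : ℝ) ≤ 2.4495 := Real.sqrt_le_iff.2 ⟨by norm_num, by norm_num⟩
  have hbase : (1.559 : ℝ) ≤ 1 + r * (1.37 / √p) := by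
    have : r * (1.37 / √p) = 1.37 / √6 := by rw [hr]; field_simp
    rw [this]
    have : (0.559 : ℝ) ≤ 1.37 / √6 := by
      rw [le_div_iff₀ h6]
      linarith
    linarith
  have hbern : (1.559 : ℝ) ≤ (1 + 1.37 / √p) ^ r :=
    hbase.trans (one_add_mul_self_le_rpow_one_add
      (by linarith [div_nonneg (by norm_num : (0 : ℝ) ≤ 1.37) hsp.le]) hr1)
  have hcube : r ≤ (1.559 : ℝ) ^ (3 * (r - 1)) := by
    rw [Real.rpow_mul (by norm_num)]
    calc r ≤ Real.exp (r - 1) := by linarith [Real.add_one_le_exp (r - 1)]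
      _ = Real.exp 1 ^ (r - 1) := (Real.exp_one_rpow _).symm
      _ ≤ ((1.559 : ℝ) ^ (3 : ℝ)) ^ (r - 1) := by
        gcongr
        have : ((1.559 : ℝ) ^ (3 : ℝ)) = 1.559 ^ (3 : ℕ) := by norm_cast
        rw [this]
        linarith [Real.exp_one_lt_d9, (by norm_num : (2.72 : ℝ) ≤ 1.559 ^ (3 : ℕ))]
  have hsplit : (1.559 : ℝ) ^ (6 * r) = 1.559 ^ (6 : ℕ) * (1.559 ^ (3 * (r - 1))) ^ 2 := by
    rw [← Real.rpow_natCast, ← Real.rpow_natCast, ← Real.rpow_mul (by norm_num),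
      ← Real.rpow_add (by norm_num)]
    congr 1
    push_cast
    ring
  have hb0 : 0 ≤ 1 + 1.37 / √p := by positivity
  calc 14.3 * (p / 6) = 14.3 * r ^ 2 := by rw [hr2]
    _ ≤ 1.559 ^ (6 : ℕ) * (1.559 ^ (3 * (r - 1))) ^ 2 := by
      gcongr
      norm_num
    _ = (1.559 : ℝ) ^ (6 * r) := hsplit.symm
    _ ≤ ((1 + 1.37 / √p) ^ r) ^ (6 * r) := by gcongr
    _ = (1 + 1.37 / √p) ^ p := by
      rw [← Real.rpow_mul hb0]
      congr 1
      nlinarith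

/-- If `p e σ ^ p > 1` then `σ (1 + σ ^ p) ^ (-1 / p) > 1 - e`. -/
lemma one_sub_lt_mul_rpow_neg {p σ e : ℝ} (hp : 1 ≤ p) (hσ : 0 < σ) (he0 : 0 ≤ e) (he1 : e < 1)
    (h : 1 < p * e * σ ^ p) : 1 - e < σ * (1 + σ ^ p) ^ (-1 / p) := by
  have hp0 : 0 < p := by linarith
  have hσp : 0 < σ ^ p := Real.rpow_pos_of_pos hσ p
  have h1e : 0 < 1 - e := by linarith
  rw [← Real.rpow_lt_rpow_iff h1e.le (by positivity) hp0,
    Real.mul_rpow hσ.le (by positivity), ← Real.rpow_mul (by positivity),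
    div_mul_cancel₀ _ hp0.ne', Real.rpow_neg_one, ← div_eq_mul_inv, lt_div_iff₀ (by positivity)]
  have hb := one_add_mul_self_le_rpow_one_add (s := e) (by linarith) hp
  have hprod : (1 - e) ^ p * (1 + e) ^ p ≤ 1 := by
    rw [← Real.mul_rpow h1e.le (by linarith)]
    exact Real.rpow_le_one (by nlinarith) (by nlinarith) hp0.le
  have hq : 0 < (1 - e) ^ p := Real.rpow_pos_of_pos h1e p
  calc (1 - e) ^ p * (1 + σ ^ p) < (1 - e) ^ p * ((1 + p * e) * σ ^ p) := by
        gcongr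
        linarith
    _ ≤ (1 - e) ^ p * ((1 + e) ^ p * σ ^ p) := by gcongr
    _ = (1 - e) ^ p * (1 + e) ^ p * σ ^ p := by ring
    _ ≤ 1 * σ ^ p := by gcongr
    _ = σ ^ p := one_mul _

/-- For every real `p ≥ 6` and every `σ` with
`1 + 1.37/√p ≤ σ ≤ σ_p`, one has `Δ(p,σ) > Δ(p,1)`. -/
theorem stmt_12 (p : ℝ) (hp : 6 ≤ p) (τp : ℝ)
    (hτp : 0 ≤ τp ∧ τp < 1 ∧ 2 * (1 - τp) ^ p = 1 + τp ^ p)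
    (T : ℝ → ℝ)
    (hT : ∀ σ ∈ Set.Icc 1 (sigmaP p),
      0 ≤ T σ ∧ T σ ≤ τp ∧ Acoef p σ (T σ) ^ p + Bcoef p σ (T σ) ^ p = 1)
    (σ : ℝ) (hσ : σ ∈ Set.Icc (1 + 1.37 / Real.sqrt p) (sigmaP p)) :
    DeltaFun p T σ > DeltaFun p T 1 := by
  have hp0 : 0 < p := by linarith
  obtain ⟨hτ0, hτ1, hτ⟩ := hτp
  obtain ⟨hσl, hσu⟩ := hσ
  have hsp : 0 < √p := Real.sqrt_pos.2 hp0
  have hσ1 : 1 ≤ σ := le_trans (by linarith [div_pos (by norm_num : (0 : ℝ) < 1.37) hsp]) hσl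
  have hσ0 : 0 < σ := by linarith
  obtain ⟨hs0, hsτ, -⟩ := hT σ ⟨hσ1, hσu⟩
  obtain ⟨h10, h1τ, -⟩ := hT 1 ⟨le_rfl, hσ1.trans hσu⟩
  set c := (2 : ℝ) ^ (-1 / p) with hc
  have hc0 : 0 < c := by positivity
  have hcp : c ^ p = 1 / 2 := by
    rw [hc, ← Real.rpow_mul two_pos.le, div_mul_cancel₀ _ hp0.ne', Real.rpow_neg_one]
    norm_num
  have hcτ : τp ≤ 1 - c := by
    have : c ≤ 1 - τp := by
      rw [← Real.rpow_le_rpow_iff hc0.le (by linarith) hp0, hcp]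
      linarith [Real.rpow_nonneg hτ0 p]
    linarith
  have hc_half : 1 / 2 ≤ c := by
    rw [← Real.rpow_le_rpow_iff (by norm_num) hc0.le hp0, hcp]
    simpa using Real.rpow_le_rpow_of_exponent_ge (by norm_num : (0 : ℝ) < 1 / 2) (by norm_num)
      (by linarith : 1 ≤ p)
  have hε := le_mul_one_sub_two_rpow hp
  rw [← hc] at hε
  have hgrow : 14.3 * (p / 6) ≤ σ ^ p :=
    (mul_le_one_add_div_sqrt_rpow hp).trans (Real.rpow_le_rpow (by positivity) hσl hp0.le)
  have hbig : 1 < p * (1 - c) ^ 2 * σ ^ p := by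
    calc (1 : ℝ) < 14.3 / 6 * 0.653 ^ 2 := by norm_num
      _ ≤ 14.3 / 6 * (p * (1 - c)) ^ 2 := by gcongr
      _ = p * (1 - c) ^ 2 * (14.3 * (p / 6)) := by ring
      _ ≤ _ := by gcongr
  have hmain := one_sub_lt_mul_rpow_neg (by linarith) hσ0 (sq_nonneg (1 - c)) (by nlinarith) hbig
  have hmono := one_add_mul_rpow_neg_mono (by linarith : 2 ≤ p) h10 h1τ (by linarith : τp ≤ 1 / 2)
  have hs0p := Real.rpow_nonneg hs0 p
  have hτ0p := Real.rpow_nonneg hτ0 p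
  have ha : (1 + τp ^ p) ^ (-1 / p) ≤ (1 + T σ ^ p) ^ (-1 / p) :=
    Real.rpow_le_rpow_of_nonpos (by positivity)
      (by linarith [Real.rpow_le_rpow hs0 hsτ hp0.le])
      (div_nonpos_of_nonpos_of_nonneg (by norm_num) hp0.le)
  have ha0 : 0 < (1 + τp ^ p) ^ (-1 / p) := by positivity
  have hone : (1 + (1 : ℝ) ^ p) = 2 := by rw [Real.one_rpow]; norm_num
  unfold DeltaFun
  rw [gt_iff_lt, hone, ← hc]
  have hb0 : 0 < (1 + σ ^ p) ^ (-1 / p) := by positivity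
  calc (T 1 + 1) * (1 + T 1 ^ p) ^ (-1 / p) * c
      ≤ (1 + τp) * (1 + τp ^ p) ^ (-1 / p) * c := by rw [add_comm (T 1)]; gcongr
    _ ≤ (1 + τp ^ p) ^ (-1 / p) * (1 - (1 - c) ^ 2) := by
      rw [mul_comm (1 + τp), mul_assoc]
      gcongr
      nlinarith
    _ < (1 + τp ^ p) ^ (-1 / p) * (σ * (1 + σ ^ p) ^ (-1 / p)) := by gcongr
    _ ≤ (1 + T σ ^ p) ^ (-1 / p) * ((T σ + σ) * (1 + σ ^ p) ^ (-1 / p)) := by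
      gcongr
      linarith
    _ = _ := by ring
end

section
/- For p = 2, the function σ ↦ Δ(2,σ) is constant on the interval [1, σ_2] = [1, √3], with Δ(2,σ) = √3/2 for all σ ∈ [1, √3]. -/
theorem sigmaP_two : sigmaP 2 = Real.sqrt 3 := by
  rw [sigmaP, Real.rpow_two, Real.sqrt_eq_rpow]
  norm_num

theorem one_add_sq_rpow_neg_half_sq (t : ℝ) :
    ((1 + t ^ (2 : ℝ)) ^ (-1 / 2 : ℝ)) ^ 2 * (1 + t ^ 2) = 1 := by
  have h : 0 < 1 + t ^ 2 := by positivity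
  rw [Real.rpow_two, ← Real.rpow_natCast, ← Real.rpow_mul h.le]
  norm_num [Real.rpow_neg_one, h.ne']

/-- The rotation identity behind the case `p = 2`: if `u = (1 + t²)^{-1/2}` and
`v = (1 + s²)^{-1/2}`, then `uv(1 - st)` and `uv(s + t)` are the cosine and sine of one angle. -/
theorem sq_add_mul_eq_of_unit {s t u v : ℝ} (hu : u ^ 2 * (1 + t ^ 2) = 1)
    (hv : v ^ 2 * (1 + s ^ 2) = 1) (h : (u - v) ^ 2 + (s * v + t * u) ^ 2 = 1) :
    ((t + s) * u * v) ^ 2 = 3 / 4 := by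
  have hc : u * v * (1 - s * t) = 1 / 2 := by linear_combination (hu + hv - h) / 2
  linear_combination v ^ 2 * (1 + s ^ 2) * hu + hv - (u * v * (1 - s * t) + 1 / 2) * hc

/-- For `p = 2`, the function `σ ↦ Δ(2,σ)` is constant on
`[1, σ_2] = [1, √3]`, with value `√3 / 2`. -/
theorem stmt_14 (τp : ℝ)
    (hτp : 0 ≤ τp ∧ τp < 1 ∧ 2 * (1 - τp) ^ (2 : ℝ) = 1 + τp ^ (2 : ℝ))
    (T : ℝ → ℝ)
    (hT : ∀ σ ∈ Set.Icc 1 (sigmaP 2),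
      0 ≤ T σ ∧ T σ ≤ τp ∧ Acoef 2 σ (T σ) ^ (2 : ℝ) + Bcoef 2 σ (T σ) ^ (2 : ℝ) = 1) :
    sigmaP 2 = Real.sqrt 3 ∧
    ∀ σ ∈ Set.Icc 1 (Real.sqrt 3), DeltaFun 2 T σ = Real.sqrt 3 / 2 := by
  refine ⟨sigmaP_two, fun σ hσ => ?_⟩
  obtain ⟨hT0, -, h⟩ := hT σ (by rwa [sigmaP_two])
  have hσ0 : 0 ≤ σ := zero_le_one.trans hσ.1
  rw [Real.rpow_two, Real.rpow_two, Acoef, Bcoef] at h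
  have hsq := sq_add_mul_eq_of_unit (one_add_sq_rpow_neg_half_sq (T σ))
    (one_add_sq_rpow_neg_half_sq σ) h
  rw [DeltaFun, ← sq_eq_sq₀ (by positivity) (by positivity), hsq, div_pow,
    Real.sq_sqrt (by norm_num)]
  norm_num
end
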